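/- arXiv:2311.17333 — 2 statements merged into one kernel-verified Lean document; each statement's English description precedes it below -/
import Mathlib

section
/- Let a : ℕ → ℝ be nonnegative and summable. For n ∈ ℕ define e_n := ∑' over the set of n-element finite subsets S of ℕ of ∏_{j ∈ S} a j (so e_0 = 1), and for k ≥ 1 define p_k := ∑'_{j} (a j)^k. Then for every n ≥ 1, n · e_n = ∑_{k=1}^{n} (−1)^{k−1} · p_k · e_{n−k}. -/
open scoped BigOperators

lemma finite_newton (a : ℕ → ℝ) (N n : ℕ) (hn : 1 ≤ n) :
    (n : ℝ) * (∑ S ∈ (Finset.range N).powersetCard n, ∏ j ∈ S, a j) =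
      ∑ k ∈ Finset.Icc 1 n, (-1 : ℝ) ^ (k - 1) * (∑ j ∈ Finset.range N, a j ^ k) *
        (∑ S ∈ (Finset.range N).powersetCard (n - k), ∏ j ∈ S, a j) := by
  have h := congrArg (MvPolynomial.aeval (fun i : Fin N => a i))
    (MvPolynomial.mul_esymm_eq_sum (Fin N) ℝ n)
  have hm : (Finset.univ : Finset (Fin N)).val.map (fun i : Fin N => a i)
      = (Finset.range N).val.map a := by
    have : (Finset.range N) = (Finset.univ : Finset (Fin N)).map Fin.valEmbedding := by
      ext x
      simp [Fin.exists_iff]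
    rw [this, Finset.map_val, Multiset.map_map]
    rfl
  have he : ∀ m, MvPolynomial.aeval (fun i : Fin N => a i) (MvPolynomial.esymm (Fin N) ℝ m)
      = ∑ S ∈ (Finset.range N).powersetCard m, ∏ j ∈ S, a j := by
    intro m
    rw [MvPolynomial.aeval_esymm_eq_multiset_esymm, hm, Finset.esymm_map_val]
  have hps : ∀ m, MvPolynomial.aeval (fun i : Fin N => a i) (MvPolynomial.psum (Fin N) ℝ m)
      = ∑ j ∈ Finset.range N, a j ^ m := by
    intro m
    simp [MvPolynomial.psum, Finset.sum_range]
  simp only [map_mul, map_sum, map_pow, map_neg, map_one, map_natCast, he, hps] at h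
  rw [h, Finset.mul_sum]
  refine Finset.sum_nbij' (fun x => x.2) (fun k => (n - k, k)) ?_ ?_ ?_ ?_ ?_
  · rintro ⟨x, y⟩ hx
    simp at hx ⊢
    omega
  · intro k hk
    simp at hk ⊢
    omega
  · rintro ⟨x, y⟩ hx
    simp at hx ⊢
    omega
  · intro k hk
    rfl
  · rintro ⟨x, y⟩ hx
    simp at hx
    obtain ⟨rfl, hy⟩ := hx
    obtain ⟨z, rfl⟩ : ∃ z, y = z + 1 := ⟨y - 1, by omega⟩
    have h1 : x + (z + 1) - (z + 1) = x := by omega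
    have h2 : ((-1 : ℝ)) ^ (x + (z + 1) + 1) * (-1) ^ x = (-1) ^ z := by
      rw [← pow_add, show x + (z + 1) + 1 + x = z + 2 * (x + 1) by ring, pow_add, pow_mul]
      simp
    simp only [h1, Nat.add_sub_cancel]
    rw [← h2]
    ring

lemma tendsto_esymm (a : ℕ → ℝ) (ha0 : ∀ j, 0 ≤ a j) (ha : Summable a) (n : ℕ) :
    Filter.Tendsto (fun N => ∑ S ∈ (Finset.range N).powersetCard n, ∏ j ∈ S, a j) Filter.atTop
      (nhds (∑' S : {S : Finset ℕ // S.card = n}, ∏ j ∈ (S : Finset ℕ), a j)) := by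
  have hs : Summable (fun S : Finset ℕ => ∏ j ∈ S, a j) :=
    summable_finsetProd_of_summable_nonneg ha0 ha
  have h1 := (hs.indicator {S : Finset ℕ | S.card = n}).hasSum
  have h2 := tsum_subtype {S : Finset ℕ | S.card = n} (fun S : Finset ℕ => ∏ j ∈ S, a j)
  rw [← h2] at h1
  have ht : Filter.Tendsto (fun N => (Finset.range N).powerset) Filter.atTop Filter.atTop := by
    refine Filter.tendsto_atTop_finset_of_monotone ?_ ?_
    · intro x y hxy
      exact Finset.powerset_mono.2 (Finset.range_mono hxy)
    · intro S
      obtain ⟨m, hm⟩ := S.exists_nat_subset_range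
      exact ⟨m, Finset.mem_powerset.2 hm⟩
  refine (Filter.Tendsto.comp h1 ht).congr ?_
  intro N
  simp only [Function.comp, Set.indicator_apply, Set.mem_setOf_eq]
  rw [← Finset.sum_filter, ← Finset.powersetCard_eq_filter]

/-- The fermionic trace recursion (Newton-type identity for infinitely many
variables): `n·e_n = ∑_{k=1}^n (-1)^{k-1} p_k e_{n-k}` for a nonnegative
summable sequence. -/
theorem fermionic_trace_recursion (a : ℕ → ℝ)
    (ha0 : ∀ j, 0 ≤ a j) (ha : Summable a)
    (e : ℕ → ℝ)
    (he : ∀ n : ℕ, e n = ∑' S : {S : Finset ℕ // S.card = n}, ∏ j ∈ (S : Finset ℕ), a j)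
    (p : ℕ → ℝ)
    (hp : ∀ k : ℕ, 1 ≤ k → p k = ∑' j : ℕ, (a j) ^ k)
    (n : ℕ) (hn : 1 ≤ n) :
    (n : ℝ) * e n = ∑ k ∈ Finset.Icc 1 n, (-1 : ℝ) ^ (k - 1) * p k * e (n - k) := by
  have hE : ∀ m, Filter.Tendsto
      (fun N => ∑ S ∈ (Finset.range N).powersetCard m, ∏ j ∈ S, a j) Filter.atTop
      (nhds (e m)) := fun m => by
    rw [he]
    exact tendsto_esymm a ha0 ha m
  have hP : ∀ k, 1 ≤ k → Filter.Tendsto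
      (fun N => ∑ j ∈ Finset.range N, a j ^ k) Filter.atTop (nhds (p k)) := fun k hk => by
    rw [hp k hk]
    refine (Summable.hasSum ?_).tendsto_sum_nat
    refine Summable.of_norm_bounded_eventually_nat ha ?_
    filter_upwards [ha.tendsto_atTop_zero.eventually_le_const one_pos] with j hj
    rw [Real.norm_of_nonneg (pow_nonneg (ha0 j) k)]
    exact pow_le_of_le_one (ha0 j) hj (by omega)
  refine tendsto_nhds_unique ((hE n).const_mul (n : ℝ)) ?_
  simp only [finite_newton a _ n hn]
  refine tendsto_finsetSum _ fun k hk => ?_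
  exact ((hP k (Finset.mem_Icc.1 hk).1).const_mul _).mul (hE (n - k))
end

section
/- Let a : ℕ → ℝ be nonnegative and summable and let n ∈ ℕ. Then the function S ↦ ∏_{j ∈ S} a j, defined on the set of n-element finite subsets S of ℕ, is summable, and its sum e_n satisfies e_n ≤ (∑'_{j} a j)^n / n!. -/
open scoped BigOperators

lemma esymm_aux_pow (p x : ℝ) (hp : 0 ≤ p) (hx : 0 ≤ x) (n : ℕ) :
    p ^ (n + 1) + (n + 1) * x * p ^ n ≤ (p + x) ^ (n + 1) := by
  induction n with
  | zero => simp
  | succ n ih =>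
    have h := mul_le_mul_of_nonneg_right ih (add_nonneg hp hx)
    have h2 : 0 ≤ ((n : ℝ) + 1) * x * p ^ n * x := by positivity
    rw [pow_succ (p + x) (n + 1)]
    refine le_trans ?_ h
    push_cast
    have h4 : (p ^ (n + 1) + ((n : ℝ) + 1) * x * p ^ n) * (p + x)
        = p ^ (n + 1 + 1) + ((n : ℝ) + 1 + 1) * x * p ^ (n + 1)
          + ((n : ℝ) + 1) * x * p ^ n * x := by ring
    linarith

lemma esymm_aux_finite (a : ℕ → ℝ) (ha0 : ∀ j, 0 ≤ a j) (s : Finset ℕ) :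
    ∀ n : ℕ, (n.factorial : ℝ) * ∑ T ∈ s.powersetCard n, ∏ j ∈ T, a j ≤ (∑ j ∈ s, a j) ^ n := by
  induction s using Finset.induction_on with
  | empty =>
    intro n
    cases n with
    | zero => simp
    | succ n => 
      rw [Finset.powersetCard_eq_empty.2 (by simp)]
      simp
  | insert x s hx ih =>
    intro n
    cases n with
    | zero => simp
    | succ n =>
      have hmem : ∀ T ∈ s.powersetCard n, x ∉ T := fun T hT h =>
        hx ((Finset.mem_powersetCard.1 hT).1 h)
      have hdisj : Disjoint (s.powersetCard (n + 1)) ((s.powersetCard n).image (insert x)) := by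
        rw [Finset.disjoint_left]
        intro T hT hT2
        obtain ⟨U, _, rfl⟩ := Finset.mem_image.1 hT2
        exact hx ((Finset.mem_powersetCard.1 hT).1 (Finset.mem_insert_self x U))
      have hinj : Set.InjOn (insert x) (s.powersetCard n : Set (Finset ℕ)) := by
        intro T hT U hU h
        have h2 := congrArg (fun V => Finset.erase V x) h
        simpa [Finset.erase_insert (hmem T hT), Finset.erase_insert (hmem U hU)] using h2
      have himg : ∑ T ∈ (s.powersetCard n).image (insert x), ∏ j ∈ T, a j
          = a x * ∑ T ∈ s.powersetCard n, ∏ j ∈ T, a j := by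
        rw [Finset.sum_image hinj, Finset.mul_sum]
        exact Finset.sum_congr rfl fun T hT => Finset.prod_insert (hmem T hT)
      rw [Finset.powersetCard_succ_insert hx, Finset.sum_union hdisj, himg,
        Finset.sum_insert hx, add_comm (a x)]
      refine le_trans ?_ (esymm_aux_pow _ _ (Finset.sum_nonneg fun j _ => ha0 j) (ha0 x) n)
      have h1 := ih (n + 1)
      have h2 := mul_le_mul_of_nonneg_left (ih n)
        (mul_nonneg (by positivity : (0 : ℝ) ≤ n + 1) (ha0 x))
      have h3 : ((n + 1).factorial : ℝ) = (n + 1) * n.factorial := by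
        rw [Nat.factorial_succ]; push_cast; rfl
      rw [mul_add]
      refine add_le_add h1 (le_trans (le_of_eq ?_) h2)
      rw [h3]; ring

/-- Summability of the `n`-fermion non-interacting partition function and the
bound `e_n ≤ (∑ a)^n / n!`. -/
theorem elementary_symmetric_summable_and_bound (a : ℕ → ℝ)
    (ha0 : ∀ j, 0 ≤ a j) (ha : Summable a) (n : ℕ) :
    Summable (fun S : {S : Finset ℕ // S.card = n} => ∏ j ∈ (S : Finset ℕ), a j) ∧
      (∑' S : {S : Finset ℕ // S.card = n}, ∏ j ∈ (S : Finset ℕ), a j) ≤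
        (∑' j : ℕ, a j) ^ n / n.factorial := by
  have hnn : ∀ S : {S : Finset ℕ // S.card = n}, 0 ≤ ∏ j ∈ (S : Finset ℕ), a j :=
    fun S => Finset.prod_nonneg fun j _ => ha0 j
  have key : ∀ u : Finset {S : Finset ℕ // S.card = n},
      ∑ S ∈ u, ∏ j ∈ (S : Finset ℕ), a j ≤ (∑' j : ℕ, a j) ^ n / n.factorial := by
    intro u
    rw [le_div_iff₀ (by positivity), mul_comm]
    let s : Finset ℕ := u.biUnion fun S => (S : Finset ℕ)
    have h1 : ∑ S ∈ u, ∏ j ∈ (S : Finset ℕ), a j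
        ≤ ∑ T ∈ s.powersetCard n, ∏ j ∈ T, a j := by
      refine le_trans (le_of_eq (Finset.sum_map u (Function.Embedding.subtype _)
        (fun T => ∏ j ∈ T, a j)).symm) ?_
      refine Finset.sum_le_sum_of_subset_of_nonneg ?_
        fun T _ _ => Finset.prod_nonneg fun j _ => ha0 j
      intro T hT
      obtain ⟨S, hS, rfl⟩ := Finset.mem_map.1 hT
      exact Finset.mem_powersetCard.2
        ⟨Finset.subset_biUnion_of_mem (fun S : {S : Finset ℕ // S.card = n} => (S : Finset ℕ)) hS,
          S.2⟩
    calc _ ≤ (n.factorial : ℝ) * ∑ T ∈ s.powersetCard n, ∏ j ∈ T, a j :=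
          mul_le_mul_of_nonneg_left h1 (by positivity)
      _ ≤ (∑ j ∈ s, a j) ^ n := esymm_aux_finite a ha0 s n
      _ ≤ _ := pow_le_pow_left₀ (Finset.sum_nonneg fun j _ => ha0 j)
          (ha.sum_le_tsum s fun j _ => ha0 j) n
  have hs := summable_of_sum_le hnn key
  exact ⟨hs, hs.tsum_le_of_sum_le key⟩
end
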